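/- Let n be a nonnegative integer and let q, α, c, d be complex numbers with q ≠ 0, c ≠ 0, d ≠ 0, α ≠ 1, and such that (q;q)_n, (αq;q)_n, (αc;q)_n, (αd;q)_n and (q²/c;q)_n are all nonzero. Then Σ_{k=0}^{n} [(q^{−n};q)_k (α q^{n+1};q)_k (q/c;q)_k / ((q;q)_k (αd;q)_k (q²/c;q)_k)] d^k = (q/c)^n · ((αc;q)_n (q;q)_n / ((q²/c;q)_n (αq;q)_n)) · Σ_{j=0}^{n} (−1)^j [(1 − α q^{2j}) (α;q)_j (q/c;q)_j (q/d;q)_j / ((1 − α) (q;q)_j (αc;q)_j (αd;q)_j)] (cd/q)^j q^{−j(j+1)/2}. -/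

import Mathlib

/-- Finite q-Pochhammer symbol `(x; q)_n`. -/
noncomputable def qPoch (x q : ℂ) (n : ℕ) : ℂ := ∏ k ∈ Finset.range n, (1 - x * q ^ k)

theorem qPoch_zero (x q : ℂ) : qPoch x q 0 = 1 := by simp [qPoch]

theorem qPoch_succ (x q : ℂ) (n : ℕ) : qPoch x q (n + 1) = qPoch x q n * (1 - x * q ^ n) :=
  Finset.prod_range_succ _ _

theorem qPoch_succ' (x q : ℂ) (n : ℕ) : qPoch x q (n + 1) = (1 - x) * qPoch (x * q) q n := by
  simp only [qPoch, Finset.prod_range_succ', pow_zero, mul_one]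
  rw [mul_comm]
  congr 1
  exact Finset.prod_congr rfl fun k _ => by ring

theorem one_sub_mul_qPoch (x q : ℂ) (n : ℕ) :
    (1 - x) * qPoch (x * q) q n = qPoch x q n * (1 - x * q ^ n) := by
  rw [← qPoch_succ', qPoch_succ]

theorem qPoch_ne_zero_of_le {x q : ℂ} {k n : ℕ} (hkn : k ≤ n) (h : qPoch x q n ≠ 0) :
    qPoch x q k ≠ 0 := by
  simp only [qPoch, Finset.prod_ne_zero_iff, Finset.mem_range] at h ⊢
  exact fun i hi => h i (by omega)

theorem qPoch_inv_pow_succ_self {q : ℂ} (hq : q ≠ 0) (n : ℕ) :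
    qPoch (q ^ n)⁻¹ q (n + 1) = 0 := by
  rw [qPoch_succ, inv_mul_cancel₀ (pow_ne_zero n hq), sub_self, mul_zero]

/-- The `q`-Chu–Vandermonde sum. -/
theorem sum_qPoch_chu_vandermonde {q : ℂ} (hq : q ≠ 0) (y : ℂ) (m : ℕ) (a : ℂ)
    (h1 : qPoch q q m ≠ 0) (h2 : qPoch (a * y) q m ≠ 0) :
    ∑ k ∈ Finset.range (m + 1), qPoch (q ^ m)⁻¹ q k * qPoch a q k /
      (qPoch q q k * qPoch (a * y) q k) * (y * q ^ m) ^ k = qPoch y q m / qPoch (a * y) q m := by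
  induction m generalizing a with
  | zero => simp [qPoch_zero]
  | succ m ih =>
    have h2' := h2
    rw [qPoch_succ'] at h2'
    obtain ⟨hay, haqy⟩ := mul_ne_zero_iff.mp h2'
    have hcomm : a * y * q = a * q * y := by ring
    rw [hcomm] at haqy
    have h1m := qPoch_ne_zero_of_le m.le_succ h1
    have h2m := qPoch_ne_zero_of_le m.le_succ h2
    have ih1 := ih a h1m h2m
    have ih2 := ih (a * q) h1m haqy
    have hQ := pow_ne_zero m hq
    have hsum : ∑ k ∈ Finset.range (m + 1), qPoch (q ^ m)⁻¹ q k * qPoch a q k /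
        (qPoch q q k * qPoch (a * y) q k) * (y * q ^ m) ^ k =
        ∑ k ∈ Finset.range (m + 1 + 1), qPoch (q ^ m)⁻¹ q k * qPoch a q k /
        (qPoch q q k * qPoch (a * y) q k) * (y * q ^ m) ^ k := by
      rw [Finset.sum_range_succ _ (m + 1), qPoch_inv_pow_succ_self hq]
      simp
    have hrec : ∑ k ∈ Finset.range (m + 1 + 1), qPoch (q ^ (m + 1))⁻¹ q k * qPoch a q k /
        (qPoch q q k * qPoch (a * y) q k) * (y * q ^ (m + 1)) ^ k =
        qPoch y q m / qPoch (a * y) q m -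
          q ^ m * y * (1 - a) / (1 - a * y) * (qPoch y q m / qPoch (a * q * y) q m) := by
      rw [← ih1, hsum, ← ih2, Finset.sum_range_succ', Finset.sum_range_succ' _ (m + 1),
        Finset.mul_sum, add_sub_right_comm, ← Finset.sum_sub_distrib]
      simp only [qPoch_zero, pow_zero]
      congr 1
      refine Finset.sum_congr rfl fun k hk => ?_
      have hk' : k + 1 ≤ m + 1 := by simpa using hk
      have hqk := qPoch_ne_zero_of_le hk' h1
      have hak := qPoch_ne_zero_of_le (Nat.le_of_succ_le_succ hk') haqy
      have hshift : (q ^ (m + 1))⁻¹ * q = (q ^ m)⁻¹ := by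
        field_simp
        ring
      rw [qPoch_succ' (q ^ (m + 1))⁻¹, hshift, qPoch_succ (q ^ m)⁻¹, qPoch_succ' a,
        qPoch_succ' (a * y), hcomm]
      rw [qPoch_succ] at hqk ⊢
      obtain ⟨hqk1, hqk2⟩ := mul_ne_zero_iff.mp hqk
      generalize qPoch (q ^ m)⁻¹ q k = X
      generalize qPoch (a * q) q k = Y
      generalize qPoch (a * q * y) q k = Z at *
      generalize qPoch q q k = V at *
      rw [mul_pow, mul_pow, pow_succ q m, mul_pow (q ^ m) q]
      simp only [pow_succ]
      field_simp
      ring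
    rw [hrec]
    have hshift := one_sub_mul_qPoch (a * y) q m
    rw [hcomm] at hshift
    rw [qPoch_succ] at h2
    obtain ⟨-, hlast⟩ := mul_ne_zero_iff.mp h2
    have hdiv : qPoch y q m / qPoch (a * q * y) q m =
        qPoch y q m * (1 - a * y) / (qPoch (a * y) q m * (1 - a * y * q ^ m)) := by
      rw [← hshift]
      field_simp
    rw [hdiv, qPoch_succ, qPoch_succ]
    field_simp
    ring

theorem qPoch_mul_inv_pow {q d : ℂ} (hq : q ≠ 0) (hd : d ≠ 0) (m : ℕ) :
    qPoch (d * (q ^ m)⁻¹) q m =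
      (-1) ^ m * d ^ m * qPoch (q / d) q m * q ^ (-((m * (m + 1) / 2 : ℕ) : ℤ)) := by
  induction m with
  | zero => simp [qPoch_zero]
  | succ m ih =>
    have hshift : d * (q ^ (m + 1))⁻¹ * q = d * (q ^ m)⁻¹ := by
        field_simp
        ring
    have htri : (m + 1) * (m + 1 + 1) / 2 = m * (m + 1) / 2 + (m + 1) := by
      rw [show (m + 1) * (m + 1 + 1) = m * (m + 1) + (m + 1) * 2 by ring,
        Nat.add_mul_div_right _ _ two_pos]
    rw [qPoch_succ', hshift, ih, qPoch_succ, htri]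
    simp only [zpow_neg, zpow_natCast, pow_add, pow_one]
    field_simp
    ring

/-- Recurrence in `n` for the terminating `₃φ₂` sum. -/
theorem sum_qPoch_recurrence {n : ℕ} {q α c d : ℂ} (hq : q ≠ 0) (hc : c ≠ 0)
    (h1 : qPoch q q (n + 1) ≠ 0) (h4 : qPoch (α * d) q (n + 1) ≠ 0)
    (h5 : qPoch (q ^ 2 / c) q (n + 1) ≠ 0) :
    (1 - α * q ^ (n + 1)) * (1 - q ^ (n + 2) / c) *
      ∑ k ∈ Finset.range (n + 1 + 1),
        qPoch (q ^ (n + 1))⁻¹ q k * qPoch (α * q ^ (n + 2)) q k * qPoch (q / c) q k /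
        (qPoch q q k * qPoch (α * d) q k * qPoch (q ^ 2 / c) q k) * d ^ k
    = (q / c) * (1 - α * c * q ^ n) * (1 - q ^ (n + 1)) *
      ∑ k ∈ Finset.range (n + 1),
        qPoch (q ^ n)⁻¹ q k * qPoch (α * q ^ (n + 1)) q k * qPoch (q / c) q k /
        (qPoch q q k * qPoch (α * d) q k * qPoch (q ^ 2 / c) q k) * d ^ k +
      (1 - α * q ^ (2 * (n + 1))) * (1 - q / c) *
        (qPoch (d * (q ^ (n + 1))⁻¹) q (n + 1) / qPoch (α * d) q (n + 1)) := by
  have hQ := pow_ne_zero (n + 1) hq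
  have hay : α * q ^ (n + 1) * (d * (q ^ (n + 1))⁻¹) = α * d := by field_simp
  have hz : d * (q ^ (n + 1))⁻¹ * q ^ (n + 1) = d := by field_simp
  have hcv := sum_qPoch_chu_vandermonde hq (d * (q ^ (n + 1))⁻¹) (n + 1) (α * q ^ (n + 1)) h1
    (by rwa [hay])
  rw [hay, hz] at hcv
  have hsum : ∑ k ∈ Finset.range (n + 1),
        qPoch (q ^ n)⁻¹ q k * qPoch (α * q ^ (n + 1)) q k * qPoch (q / c) q k /
        (qPoch q q k * qPoch (α * d) q k * qPoch (q ^ 2 / c) q k) * d ^ k =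
      ∑ k ∈ Finset.range (n + 1 + 1),
        qPoch (q ^ n)⁻¹ q k * qPoch (α * q ^ (n + 1)) q k * qPoch (q / c) q k /
        (qPoch q q k * qPoch (α * d) q k * qPoch (q ^ 2 / c) q k) * d ^ k := by
    rw [Finset.sum_range_succ _ (n + 1), qPoch_inv_pow_succ_self hq]
    simp
  rw [← hcv, hsum, Finset.mul_sum, Finset.mul_sum, Finset.mul_sum, ← Finset.sum_add_distrib]
  refine Finset.sum_congr rfl fun k hk => ?_
  have hk' : k ≤ n + 1 := Nat.le_of_lt_succ (Finset.mem_range.mp hk)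
  have hck := qPoch_ne_zero_of_le hk' h5
  have e1 := one_sub_mul_qPoch (α * q ^ (n + 1)) q k
  have e2 := one_sub_mul_qPoch (q ^ (n + 1))⁻¹ q k
  have e3 := one_sub_mul_qPoch (q / c) q k
  rw [show α * q ^ (n + 1) * q = α * q ^ (n + 2) by ring] at e1
  rw [show (q ^ (n + 1))⁻¹ * q = (q ^ n)⁻¹ by field_simp; ring] at e2
  rw [show q / c * q = q ^ 2 / c by ring] at e3
  have e2' : (1 - q ^ (n + 1)) * qPoch (q ^ n)⁻¹ q k =
      qPoch (q ^ (n + 1))⁻¹ q k * (q ^ k - q ^ (n + 1)) := by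
    have : (1 - q ^ (n + 1)) = -q ^ (n + 1) * (1 - (q ^ (n + 1))⁻¹) := by
      field_simp
      ring
    rw [this, mul_assoc, e2]
    field_simp
    ring
  have key : (1 - α * q ^ (n + 1) * q ^ k) * (1 - q ^ (n + 2) / c) =
      (q / c) * (1 - α * c * q ^ n) * (q ^ k - q ^ (n + 1)) +
      (1 - α * q ^ (2 * (n + 1))) * (1 - q / c * q ^ k) := by
    field_simp
    ring
  generalize qPoch (q ^ (n + 1))⁻¹ q k = X at *
  generalize qPoch (q ^ n)⁻¹ q k = X' at *
  generalize qPoch (α * q ^ (n + 1)) q k = A at *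
  generalize qPoch (α * q ^ (n + 2)) q k = A' at *
  generalize qPoch (q / c) q k = W at *
  generalize qPoch (q ^ 2 / c) q k = W' at *
  generalize qPoch q q k = V at *
  generalize qPoch (α * d) q k = Z at *
  calc _ = ((1 - α * q ^ (n + 1)) * A') * (1 - q ^ (n + 2) / c) * X * W / (V * Z * W') * d ^ k := by
        ring
    _ = A * X * W * ((1 - α * q ^ (n + 1) * q ^ k) * (1 - q ^ (n + 2) / c)) / (V * Z * W') *
          d ^ k := by rw [e1]; ring
    _ = (q / c) * (1 - α * c * q ^ n) * A * W * (X * (q ^ k - q ^ (n + 1))) / (V * Z * W') * d ^ k +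
          (1 - α * q ^ (2 * (n + 1))) * A * X * (W * (1 - q / c * q ^ k)) / (V * Z * W') *
          d ^ k := by rw [key]; ring
    _ = _ := by
        rw [← e2', ← e3]
        have : (1 - α * q ^ (2 * (n + 1))) * A * X * ((1 - q / c) * W') / (V * Z * W') * d ^ k =
            (1 - α * q ^ (2 * (n + 1))) * (1 - q / c) * (X * A / (V * Z) * d ^ k) := by
          rw [show (1 - α * q ^ (2 * (n + 1))) * A * X * ((1 - q / c) * W') =
            (1 - α * q ^ (2 * (n + 1))) * A * X * (1 - q / c) * W' by ring,
            mul_div_mul_right _ _ hck]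
          ring
        rw [this]
        ring

/-- Lemma 2.2 of the paper: a terminated ₃φ₂ transformation. -/
theorem statement2 (n : ℕ) (q α c d : ℂ)
    (hq : q ≠ 0) (hc : c ≠ 0) (hd : d ≠ 0) (hα : α ≠ 1)
    (h1 : qPoch q q n ≠ 0) (h2 : qPoch (α * q) q n ≠ 0) (h3 : qPoch (α * c) q n ≠ 0)
    (h4 : qPoch (α * d) q n ≠ 0) (h5 : qPoch (q ^ 2 / c) q n ≠ 0) :
    ∑ k ∈ Finset.range (n + 1),
      qPoch (q ^ (-(n : ℤ))) q k * qPoch (α * q ^ (n + 1)) q k * qPoch (q / c) q k /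
        (qPoch q q k * qPoch (α * d) q k * qPoch (q ^ 2 / c) q k) * d ^ k
    = (q / c) ^ n *
      (qPoch (α * c) q n * qPoch q q n / (qPoch (q ^ 2 / c) q n * qPoch (α * q) q n)) *
      ∑ j ∈ Finset.range (n + 1),
        (-1 : ℂ) ^ j *
          ((1 - α * q ^ (2 * j)) * qPoch α q j * qPoch (q / c) q j * qPoch (q / d) q j /
            ((1 - α) * qPoch q q j * qPoch (α * c) q j * qPoch (α * d) q j)) *
          (c * d / q) ^ j * q ^ (-((j * (j + 1) / 2 : ℕ) : ℤ)) := by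
  simp only [zpow_neg q (n : ℤ), zpow_natCast]
  induction n with
  | zero =>
    have : 1 - α ≠ 0 := sub_ne_zero.mpr hα.symm
    simp [qPoch_zero, this]
  | succ n ih =>
    have hle := n.le_succ
    have ih := ih (qPoch_ne_zero_of_le hle h1) (qPoch_ne_zero_of_le hle h2)
      (qPoch_ne_zero_of_le hle h3) (qPoch_ne_zero_of_le hle h4) (qPoch_ne_zero_of_le hle h5)
    have hrec := sum_qPoch_recurrence (d := d) hq hc h1 h4 h5
    rw [ih, qPoch_mul_inv_pow hq hd] at hrec
    have hα' : 1 - α ≠ 0 := sub_ne_zero.mpr hα.symm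
    rw [qPoch_succ] at h2 h3 h5
    obtain ⟨h2a, h2b⟩ := mul_ne_zero_iff.mp h2
    obtain ⟨h3a, h3b⟩ := mul_ne_zero_iff.mp h3
    obtain ⟨h5a, h5b⟩ := mul_ne_zero_iff.mp h5
    have e2 : 1 - α * q * q ^ n = 1 - α * q ^ (n + 1) := by ring
    have e5 : 1 - q ^ 2 / c * q ^ n = 1 - q ^ (n + 2) / c := by ring
    rw [e2] at h2b
    rw [e5] at h5b
    refine mul_left_cancel₀ (mul_ne_zero h2b h5b) (hrec.trans ?_)
    rw [Finset.sum_range_succ _ (n + 1)]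
    generalize ∑ j ∈ Finset.range (n + 1), (_ : ℂ) = T
    clear hrec ih
    rw [qPoch_succ' α, qPoch_succ' (q / c), show q / c * q = q ^ 2 / c by ring,
      qPoch_succ (α * c), qPoch_succ (q ^ 2 / c), qPoch_succ (α * q), e2, e5]
    rw [qPoch_succ q q] at h1 ⊢
    obtain ⟨h1a, h1b⟩ := mul_ne_zero_iff.mp h1
    generalize q ^ (-(((n + 1) * (n + 1 + 1) / 2 : ℕ) : ℤ)) = E
    have hpow : (c * d / q) ^ (n + 1) = d ^ (n + 1) / (q / c) ^ (n + 1) := by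
      rw [← div_pow]
      congr 1
      field_simp
    have hqc : q / c ≠ 0 := div_ne_zero hq hc
    rw [hpow]
    have e1 : 1 - q * q ^ n = 1 - q ^ (n + 1) := by ring
    rw [e1] at h1b ⊢
    generalize 1 - q ^ (n + 2) / c = u5 at *
    generalize 1 - α * q ^ (n + 1) = u2 at *
    generalize 1 - α * c * q ^ n = u3 at *
    generalize 1 - q ^ (n + 1) = u1 at *
    generalize 1 - α * q ^ (2 * (n + 1)) = v
    generalize q / c = r at *
    field_simp
    ring
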